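/- arXiv:1612.03998 — 2 statements merged into one kernel-verified Lean document; each statement's English description precedes it below -/
import Mathlib

section
/- Let V = ℂ^m with G = O(V). Then (V^{⊗r})^G = 0 if r is odd, and if r = 2d then (V^{⊗2d})^G is spanned by the elements σ·(Č^{⊗d}) for σ ∈ S_{2d}, where Č = ∑_i e_i⊗e_i. -/
open scoped BigOperators

namespace EnhBrauer

/-- Coordinates of a tensor in `V^{⊗r}` for `V = ℂ^m`, w.r.t. the orthonormal basis. -/
abbrev Tens (m r : ℕ) := (Fin r → Fin m) → ℂ

/-- `A` is an orthogonal matrix: `A.transpose * A = 1`. -/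
def IsOrth {m : ℕ} (A : Matrix (Fin m) (Fin m) ℂ) : Prop := A.transpose * A = 1

/-- The diagonal action of a matrix on `V^{⊗r}` in coordinates. -/
noncomputable def act {m r : ℕ} (A : Matrix (Fin m) (Fin m) ℂ) (x : Tens m r) : Tens m r :=
  fun f => ∑ f' : Fin r → Fin m, (∏ i, A (f i) (f' i)) * x f'

/-- Action of a permutation on `V^{⊗r}` by permuting the tensor factors. -/
def permAct {m r : ℕ} (σ : Equiv.Perm (Fin r)) (x : Tens m r) : Tens m r :=
  fun f => x (f ∘ σ)

/-- The symmetric bilinear form on `V^{⊗r}` extending `(·,·)` multiplicatively. -/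
noncomputable def form {m r : ℕ} (x y : Tens m r) : ℂ :=
  ∑ f : Fin r → Fin m, x f * y f

/-- `Č = ∑ i, e i ⊗ e i ∈ V ⊗ V`. -/
def cC (m : ℕ) : Tens m 2 := fun f => if f 0 = f 1 then 1 else 0

/-- `Ĉ : V ⊗ V → ℂ`, `v ⊗ w ↦ (v, w)`. -/
noncomputable def hatC {m : ℕ} (x : Tens m 2) : ℂ := ∑ i : Fin m, x (fun _ => i)

/-- `Č^{⊗d} ∈ V^{⊗2d}`. -/
def cCpow (m d : ℕ) : Tens m (2 * d) :=
  fun f => ∏ i : Fin d,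
    (if f ⟨2 * i, by have := i.isLt; omega⟩ = f ⟨2 * i + 1, by have := i.isLt; omega⟩
      then (1 : ℂ) else 0)

/-- Tensor product (concatenation) of tensors. -/
def tmul {m r s : ℕ} (x : Tens m r) (y : Tens m s) : Tens m (r + s) :=
  fun f => x (fun i => f (Fin.castAdd s i)) * y (fun j => f (Fin.natAdd r j))

/-- `Λ = (m!)⁻¹ ∑_{σ ∈ S_m} ε(σ) σ · (e 1 ⊗ ⋯ ⊗ e m)`. -/
noncomputable def Lam (m : ℕ) : Tens m m :=
  fun f => ((m.factorial : ℂ))⁻¹ *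
    ∑ σ : Equiv.Perm (Fin m), ((Equiv.Perm.sign σ : ℤ) : ℂ) * (if ∀ i, f i = σ i then 1 else 0)

/-- The total antisymmetrizer `Σ_r = ∑_{π ∈ S_r} ε(π) π` on `V^{⊗r}`. -/
noncomputable def SigmaA (m r : ℕ) : Tens m r → Tens m r :=
  fun x f => ∑ σ : Equiv.Perm (Fin r), ((Equiv.Perm.sign σ : ℤ) : ℂ) * x (f ∘ σ)

/-- `x ∈ V^{⊗r}` is harmonic: contracting any two distinct tensor factors with
the form gives `0`. -/
def Harmonic {m r : ℕ} (x : Tens m r) : Prop :=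
  ∀ a b : Fin r, a ≠ b → ∀ f : Fin r → Fin m,
    ∑ j : Fin m, x (Function.update (Function.update f a j) b j) = 0

lemma act_add {m r : ℕ} (A : Matrix (Fin m) (Fin m) ℂ) (x y : Tens m r) :
    act A (x + y) = act A x + act A y := by
  funext f
  simp [act, mul_add, Finset.sum_add_distrib]

lemma act_zero {m r : ℕ} (A : Matrix (Fin m) (Fin m) ℂ) :
    act A (0 : Tens m r) = 0 := by
  funext f; simp [act]

lemma act_smul {m r : ℕ} (A : Matrix (Fin m) (Fin m) ℂ) (c : ℂ) (x : Tens m r) :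
    act A (c • x) = c • act A x := by
  funext f
  simp only [act, Pi.smul_apply, smul_eq_mul, Finset.mul_sum]
  exact Finset.sum_congr rfl fun f' _ => by ring

/-- The submodule of tensors in `V^{⊗r}` invariant under all matrices satisfying `P`. -/
noncomputable def invSub (m r : ℕ) (P : Matrix (Fin m) (Fin m) ℂ → Prop) :
    Submodule ℂ (Tens m r) where
  carrier := {x | ∀ A, P A → act A x = x}
  add_mem' := by intro x y hx hy A hA; rw [act_add, hx A hA, hy A hA]
  zero_mem' := by intro A hA; exact act_zero A
  smul_mem' := by intro c x hx A hA; rw [act_smul, hx A hA]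

/-- The submodule of linear maps `V^{⊗s} → V^{⊗t}` equivariant for all matrices
satisfying `P`. -/
noncomputable def homSub (m s t : ℕ) (P : Matrix (Fin m) (Fin m) ℂ → Prop) :
    Submodule ℂ (Tens m s →ₗ[ℂ] Tens m t) where
  carrier := {T | ∀ A, P A → ∀ x, T (act A x) = act A (T x)}
  add_mem' := by
    intro T S hT hS A hA x
    simp [hT A hA x, hS A hA x, act_add]
  zero_mem' := by
    intro A hA x
    simp [act_zero]
  smul_mem' := by
    intro c T hT A hA x
    simp [hT A hA x, act_smul]

/-- General index-type version of the diagonal action. -/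
noncomputable def gAct {m : ℕ} {ι : Type} [Fintype ι] [DecidableEq ι]
    (A : Matrix (Fin m) (Fin m) ℂ) (x : (ι → Fin m) → ℂ) : (ι → Fin m) → ℂ :=
  fun f => ∑ f' : ι → Fin m, (∏ i, A (f i) (f' i)) * x f'

lemma gAct_comp {m : ℕ} {ι κ : Type} [Fintype ι] [DecidableEq ι] [Fintype κ] [DecidableEq κ]
    (A : Matrix (Fin m) (Fin m) ℂ) (e : κ ≃ ι) (x : (κ → Fin m) → ℂ) :
    gAct A (fun f : ι → Fin m => x (f ∘ e)) = fun f => gAct A x (f ∘ e) := by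
  funext f
  unfold gAct
  refine Fintype.sum_equiv (Equiv.arrowCongr e.symm (Equiv.refl _)) _ _ ?_
  intro f'
  have h1 : (Equiv.arrowCongr e.symm (Equiv.refl (Fin m))) f' = f' ∘ e := by
    funext k; simp [Equiv.arrowCongr]
  rw [h1]
  congr 1
  exact (Equiv.prod_comp e (fun i => A (f i) (f' i))).symm

lemma gAct_sub {m : ℕ} {ι : Type} [Fintype ι] [DecidableEq ι]
    (A : Matrix (Fin m) (Fin m) ℂ) (x y : (ι → Fin m) → ℂ) :
    gAct A (x - y) = gAct A x - gAct A y := by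
  funext f
  simp [gAct, mul_sub, Finset.sum_sub_distrib]

lemma gAct_diag {m : ℕ} {ι : Type} [Fintype ι] [DecidableEq ι]
    (d : Fin m → ℂ) (x : (ι → Fin m) → ℂ) (f : ι → Fin m) :
    gAct (Matrix.diagonal d) x f = (∏ k, d (f k)) * x f := by
  unfold gAct
  rw [Finset.sum_eq_single f]
  · simp
  · intro g _ hg
    obtain ⟨k, hk⟩ := Function.ne_iff.mp hg
    rw [Finset.prod_eq_zero (Finset.mem_univ k), zero_mul]
    exact Matrix.diagonal_apply_ne _ (Ne.symm hk)
  · simp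

lemma isOrth_diag {m : ℕ} (d : Fin m → ℂ) (hd : ∀ i, d i * d i = 1) :
    IsOrth (Matrix.diagonal d) := by
  unfold IsOrth
  rw [Matrix.diagonal_transpose, Matrix.diagonal_mul_diagonal]
  simp [hd]

/-- Rotation in the coordinate plane. -/
lemma isOrth_rot {m : ℕ} (i j : Fin m) (hij : i ≠ j) (c s : ℂ) (h : c ^ 2 + s ^ 2 = 1) :
    IsOrth ((1 : Matrix (Fin m) (Fin m) ℂ) +
      (c - 1) • (Matrix.single i i 1 + Matrix.single j j 1) +
      s • (Matrix.single i j 1 - Matrix.single j i 1)) := by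
  unfold IsOrth
  set P : Matrix (Fin m) (Fin m) ℂ := Matrix.single i i 1 + Matrix.single j j 1 with hP
  set L : Matrix (Fin m) (Fin m) ℂ := Matrix.single i j 1 - Matrix.single j i 1 with hL
  have hPt : P.transpose = P := by simp [hP]
  have hLt : L.transpose = -L := by simp [hL]
  have hPP : P * P = P := by
    simp [hP, mul_add, add_mul, hij, hij.symm]
  have hPL : P * L = L := by
    simp [hP, hL, mul_sub, add_mul, hij, hij.symm]
    try abel
  have hLP : L * P = L := by
    simp [hP, hL, mul_add, sub_mul, hij, hij.symm]
    try abel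
  have hLL : L * L = -P := by
    simp [hP, hL, mul_sub, sub_mul, hij, hij.symm]
    try abel
  simp only [Matrix.transpose_add, Matrix.transpose_one, Matrix.transpose_smul, hPt, hLt]
  simp only [add_mul, mul_add, one_mul, mul_one, smul_mul_assoc, mul_smul_comm, neg_mul,
    mul_neg, smul_neg, hPP, hPL, hLP, hLL, neg_neg]
  have h2 : (c ^ 2 + s ^ 2 - 1) • P = 0 := by rw [h, sub_self, zero_smul]
  rw [← sub_eq_zero, ← h2]
  module

lemma sum_erase_delta {m : ℕ} {ι : Type} [Fintype ι] [DecidableEq ι]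
    (f : ι → Fin m) (a : ι) (h : (ι → Fin m) → ℂ) :
    ∑ f' : ι → Fin m, (∏ k ∈ Finset.univ.erase a, (1 : Matrix (Fin m) (Fin m) ℂ) (f k) (f' k)) * h f'
      = ∑ q, h (Function.update f a q) := by
  classical
  have h0 : ∀ f' : ι → Fin m,
      (∏ k ∈ Finset.univ.erase a, (1 : Matrix (Fin m) (Fin m) ℂ) (f k) (f' k)) * h f'
      = ∑ q, if f' = Function.update f a q then h f' else 0 := by
    intro f'
    by_cases hf : ∀ k, k ≠ a → f k = f' k
    · rw [Finset.prod_eq_one, one_mul, Finset.sum_eq_single (f' a)]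
      · rw [if_pos]
        funext k
        by_cases hk : k = a
        · subst hk; simp
        · simp [hk, hf k hk]
      · intro q _ hq
        rw [if_neg]
        intro h'
        apply hq
        rw [h']; simp
      · simp
      · intro k hk
        rw [hf k (Finset.ne_of_mem_erase hk), Matrix.one_apply_eq]
    · push Not at hf
      obtain ⟨k, hk, hk'⟩ := hf
      rw [Finset.prod_eq_zero (Finset.mem_erase.mpr ⟨hk, Finset.mem_univ k⟩), zero_mul]
      · symm
        apply Finset.sum_eq_zero
        intro q _
        rw [if_neg]
        intro h'
        apply hk'
        rw [h']; simp [hk]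
      · exact Matrix.one_apply_ne hk'
  simp_rw [h0]
  rw [Finset.sum_comm]
  simp

/-- The operator `E_ij`. -/
noncomputable def gE {m : ℕ} {ι : Type} [Fintype ι] [DecidableEq ι]
    (i j : Fin m) (x : (ι → Fin m) → ℂ) : (ι → Fin m) → ℂ :=
  fun f => ∑ a, if f a = i then x (Function.update f a j) else 0

lemma gE_symm {m : ℕ} {ι : Type} [Fintype ι] [DecidableEq ι]
    (x : (ι → Fin m) → ℂ) (hx : ∀ A, IsOrth A → gAct A x = x) (i j : Fin m) :
    gE i j x = gE j i x := by
  by_cases hij : i = j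
  · rw [hij]
  funext f
  set P : Matrix (Fin m) (Fin m) ℂ := Matrix.single i i 1 + Matrix.single j j 1 with hP
  set L : Matrix (Fin m) (Fin m) ℂ := Matrix.single i j 1 - Matrix.single j i 1 with hL
  let R : ℂ → Matrix (Fin m) (Fin m) ℂ := fun t =>
    1 + (Complex.cos t - 1) • P + Complex.sin t • L
  have hR : ∀ t, gAct (R t) x f = x f := fun t => by
    rw [hx _ (isOrth_rot i j hij _ _ (by rw [add_comm]; exact Complex.sin_sq_add_cos_sq t))]
  have hR0 : R 0 = 1 := by simp [R]
  have hd : ∀ p q, HasDerivAt (fun t => R t p q) (L p q) 0 := by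
    intro p q
    have h1 : HasDerivAt (fun t : ℂ => (1 : Matrix (Fin m) (Fin m) ℂ) p q
        + (Complex.cos t - 1) * P p q + Complex.sin t * L p q)
        ((-Complex.sin 0) * P p q + Complex.cos 0 * L p q) 0 :=
      ((((Complex.hasDerivAt_cos 0).sub_const 1).mul_const (P p q)).const_add _).add
        ((Complex.hasDerivAt_sin 0).mul_const _)
    simpa [R] using h1
  have hD : HasDerivAt (fun t => gAct (R t) x f)
      (∑ f' : ι → Fin m, (∑ a, (∏ k ∈ Finset.univ.erase a, R 0 (f k) (f' k)) •
        L (f a) (f' a)) * x f') 0 := by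
    unfold gAct
    apply HasDerivAt.fun_sum
    intro f' _
    apply HasDerivAt.mul_const
    exact HasDerivAt.fun_finsetProd (fun a _ => hd (f a) (f' a))
  have hz := hD.unique ((hasDerivAt_const (0:ℂ) (x f)).congr_of_eventuallyEq
    (Filter.Eventually.of_forall hR))
  rw [hR0] at hz
  simp only [smul_eq_mul, Finset.sum_mul, mul_assoc] at hz
  rw [Finset.sum_comm] at hz
  simp only [sum_erase_delta f _ (fun f' => L (f _) (f' _) * x f')] at hz
  rw [← sub_eq_zero, ← hz]
  unfold gE
  rw [← Finset.sum_sub_distrib]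
  apply Finset.sum_congr rfl
  intro a _
  simp only [Function.update_self, hL, Matrix.sub_apply, Matrix.single_apply, sub_mul,
    Finset.sum_sub_distrib]
  simp [ite_and, eq_comm]

lemma gE_adj {m : ℕ} {ι : Type} [Fintype ι] [DecidableEq ι]
    (x y : (ι → Fin m) → ℂ) (i j : Fin m) :
    ∑ f, (starRingEnd ℂ) (gE i j x f) * y f = ∑ f, (starRingEnd ℂ) (x f) * gE j i y f := by
  unfold gE
  simp only [map_sum, Finset.sum_mul, Finset.mul_sum]
  rw [Finset.sum_comm, Finset.sum_comm (s := Finset.univ (α := ι → Fin m))]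
  apply Finset.sum_congr rfl
  intro a _
  simp only [apply_ite (starRingEnd ℂ), map_zero, ite_mul, mul_ite, zero_mul, mul_zero]
  rw [← Finset.sum_filter, ← Finset.sum_filter]
  refine Finset.sum_nbij' (fun f => Function.update f a j) (fun f => Function.update f a i)
    ?_ ?_ ?_ ?_ ?_
  · simp
  · simp
  · intro f hf
    simp at hf
    simp [← hf]
  · intro f hf
    simp at hf
    simp [← hf]
  · intro f hf
    simp at hf
    simp [← hf]

lemma gE_gE {m : ℕ} {ι : Type} [Fintype ι] [DecidableEq ι]
    (x : (ι → Fin m) → ℂ)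
    (hh : ∀ a b : ι, a ≠ b → ∀ f : ι → Fin m,
      ∑ j : Fin m, x (Function.update (Function.update f a j) b j) = 0) (f : ι → Fin m) :
    ∑ i, ∑ j, gE j i (gE j i x) f = (Fintype.card ι : ℂ) * x f := by
  unfold gE
  have h1 : ∀ i j a, (if f a = j then ∑ b, (if Function.update f a i b = j then
      x (Function.update (Function.update f a i) b i) else 0) else 0)
      = (if f a = j then ∑ b, (if b = a then (if i = j then x f else 0) else
        if f b = j then x (Function.update (Function.update f a i) b i) else 0) else 0) := by
    intro i j a
    by_cases h : f a = j
    · rw [if_pos h, if_pos h]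
      apply Finset.sum_congr rfl
      intro b _
      by_cases hb : b = a
      · subst hb
        simp only [Function.update_self, if_true, Function.update_idem]
        split_ifs with h2
        · rw [h2, ← h, Function.update_eq_self]
        · rfl
      · simp [hb]
    · rw [if_neg h, if_neg h]
  simp only [h1]
  rw [Finset.sum_comm]
  have h2 : ∀ j, ∑ i, ∑ a, (if f a = j then ∑ b, (if b = a then (if i = j then x f else 0) else
        if f b = j then x (Function.update (Function.update f a i) b i) else 0) else 0)
      = ∑ a, if f a = j then x f else 0 := by
    intro j
    rw [Finset.sum_comm]
    apply Finset.sum_congr rfl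
    intro a _
    split_ifs with h
    · rw [Finset.sum_comm, Finset.sum_eq_single a]
      · simp
      · intro b _ hb
        simp only [hb, if_false]
        split_ifs
        · exact hh a b (Ne.symm hb) f
        · simp
      · simp
    · simp
  simp only [h2]
  rw [Finset.sum_comm]
  simp

lemma even_supp {m : ℕ} {ι : Type} [Fintype ι] [DecidableEq ι]
    (x : (ι → Fin m) → ℂ) (hx : ∀ A, IsOrth A → gAct A x = x) (f : ι → Fin m)
    (hf : x f ≠ 0) (i : Fin m) : Even (Finset.univ.filter (fun a => f a = i)).card := by
  have h := congrFun (hx _ (isOrth_diag (fun q => if q = i then -1 else 1)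
    (by intro q; split_ifs <;> norm_num))) f
  rw [gAct_diag, Finset.prod_ite] at h
  simp only [Finset.prod_const, one_pow, mul_one] at h
  by_contra hc
  rw [Nat.not_even_iff_odd] at hc
  rw [hc.neg_one_pow] at h
  apply hf
  linear_combination (-1/2) * h

lemma harm_zero {m : ℕ} {ι : Type} [Fintype ι] [DecidableEq ι] [Nonempty ι]
    (x : (ι → Fin m) → ℂ) (hx : ∀ A, IsOrth A → gAct A x = x)
    (hh : ∀ a b : ι, a ≠ b → ∀ f : ι → Fin m,
      ∑ j : Fin m, x (Function.update (Function.update f a j) b j) = 0) : x = 0 := by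
  set r : ℕ := Fintype.card ι with hr
  have hrpos : 0 < r := Fintype.card_pos
  have e1 : ∑ i : Fin m, ∑ j : Fin m, ∑ f, (starRingEnd ℂ) (gE i j x f) * gE i j x f
      = (r : ℂ) * ∑ f, (starRingEnd ℂ) (x f) * x f := by
    have : ∀ i j, ∑ f, (starRingEnd ℂ) (gE i j x f) * gE i j x f
        = ∑ f, (starRingEnd ℂ) (x f) * gE j i (gE j i x) f := by
      intro i j
      rw [gE_adj, gE_symm x hx i j]
    simp only [this]
    rw [Finset.mul_sum]
    calc _ = ∑ f, ∑ i, ∑ j, (starRingEnd ℂ) (x f) * gE j i (gE j i x) f := by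
          rw [Finset.sum_comm]
          simp_rw [Finset.sum_comm (s := Finset.univ (α := ι → Fin m))]
          rw [Finset.sum_comm]
      _ = _ := by
          apply Finset.sum_congr rfl
          intro f _
          simp_rw [← Finset.mul_sum]
          rw [gE_gE x hh f]
          ring
  have e2 : ∑ i : Fin m, ∑ j : Fin m, ∑ f, ‖gE i j x f‖ ^ 2 = (r : ℝ) * ∑ f, ‖x f‖ ^ 2 := by
    simp only [Complex.conj_mul'] at e1
    exact_mod_cast e1
  have e3 : ∀ i f, gE i i x f = ((Finset.univ.filter (fun a => f a = i)).card : ℂ) * x f := by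
    intro i f
    unfold gE
    have : ∀ a, (if f a = i then x (Function.update f a i) else 0) = if f a = i then x f else 0 := by
      intro a
      split_ifs with h
      · rw [← h, Function.update_eq_self]
      · rfl
    simp only [this]
    rw [← Finset.sum_filter, Finset.sum_const, nsmul_eq_mul]
  have e4 : ∑ i : Fin m, ∑ f, ‖gE i i x f‖ ^ 2 ≤ (r : ℝ) * ∑ f, ‖x f‖ ^ 2 := by
    rw [← e2]
    apply Finset.sum_le_sum
    intro i _
    exact Finset.single_le_sum (f := fun j => ∑ f, ‖gE i j x f‖ ^ 2)
      (fun j _ => Finset.sum_nonneg fun f _ => by positivity) (Finset.mem_univ i)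
  have e5 : (2 * r : ℝ) * ∑ f, ‖x f‖ ^ 2 ≤ ∑ i : Fin m, ∑ f, ‖gE i i x f‖ ^ 2 := by
    rw [Finset.sum_comm, Finset.mul_sum]
    apply Finset.sum_le_sum
    intro f _
    by_cases hf : x f = 0
    · simp only [hf, e3]; simp
    have hcard : (r : ℝ) = ∑ i, ((Finset.univ.filter (fun a => f a = i)).card : ℝ) := by
      have : r = ∑ i, (Finset.univ.filter (fun a => f a = i)).card := by
        rw [hr, ← Finset.card_univ]
        exact Finset.card_eq_sum_card_fiberwise (fun a _ => Finset.mem_coe.mpr (Finset.mem_univ _))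
      exact_mod_cast this
    rw [hcard, Finset.mul_sum, Finset.sum_mul]
    apply Finset.sum_le_sum
    intro i _
    rw [e3, norm_mul, mul_pow]
    apply mul_le_mul_of_nonneg_right _ (by positivity)
    rw [Complex.norm_natCast]
    obtain ⟨n, hn⟩ := even_supp x hx f hf i
    rw [hn]
    have : 2 * (n + n) ≤ (n + n) ^ 2 := by
      rcases Nat.eq_zero_or_pos n with h | h
      · simp [h]
      · nlinarith
    exact_mod_cast this
  have hr' : (0 : ℝ) < r := by exact_mod_cast hrpos
  have hs : 0 ≤ ∑ f, ‖x f‖ ^ 2 := Finset.sum_nonneg fun f _ => by positivity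
  have e6 : ∑ f, ‖x f‖ ^ 2 = 0 := by nlinarith
  rw [Finset.sum_eq_zero_iff_of_nonneg (fun f _ => by positivity)] at e6
  funext f
  simpa using e6 f (Finset.mem_univ f)

/-- The standard pairing tensor. -/
def gD (m d : ℕ) : (Fin d × Fin 2 → Fin m) → ℂ :=
  fun f => ∏ i : Fin d, if f (i, 0) = f (i, 1) then (1 : ℂ) else 0

/-- Extend a multi-index by a pair of entries. -/
def gext {m d : ℕ} (j k : Fin m) (g : Fin d × Fin 2 → Fin m) : Fin (d + 1) × Fin 2 → Fin m :=
  fun p => Fin.cases (if p.2 = 0 then j else k) (fun i => g (i, p.2)) p.1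

/-- Extension as an equivalence. -/
def gextE (m d : ℕ) :
    (Fin m × Fin m × (Fin d × Fin 2 → Fin m)) ≃ (Fin (d + 1) × Fin 2 → Fin m) where
  toFun t := gext t.1 t.2.1 t.2.2
  invFun F := (F (0, 0), F (0, 1), fun p => F (p.1.succ, p.2))
  left_inv := by
    rintro ⟨j, k, g⟩
    simp [gext]
  right_inv := by
    intro F
    funext ⟨i, b⟩
    refine Fin.cases ?_ (fun i => ?_) i
    · fin_cases b <;> simp [gext]
    · simp [gext]

lemma sum_gext {m d : ℕ} (h : (Fin (d + 1) × Fin 2 → Fin m) → ℂ) :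
    ∑ F, h F = ∑ j, ∑ k, ∑ g, h (gext j k g) := by
  rw [← Equiv.sum_comp (gextE m d), Fintype.sum_prod_type]
  apply Finset.sum_congr rfl
  intro j _
  rw [Fintype.sum_prod_type]
  rfl

lemma prod_gext {m d : ℕ} (A : Matrix (Fin m) (Fin m) ℂ) (j k j' k' : Fin m)
    (g g' : Fin d × Fin 2 → Fin m) :
    ∏ p, A (gext j k g p) (gext j' k' g' p) = A j j' * A k k' * ∏ p, A (g p) (g' p) := by
  rw [Fintype.prod_prod_type, Fin.prod_univ_succ, Fintype.prod_prod_type]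
  simp [gext]

lemma gD_gext {m d : ℕ} (j k : Fin m) (g : Fin d × Fin 2 → Fin m) :
    gD m (d + 1) (gext j k g) = (if j = k then 1 else 0) * gD m d g := by
  unfold gD
  rw [Fin.prod_univ_succ]
  simp [gext]

/-- Extension of a permutation by the identity on the first pair. -/
def gperm {d : ℕ} (τ : Equiv.Perm (Fin d × Fin 2)) : Equiv.Perm (Fin (d + 1) × Fin 2) where
  toFun p := Fin.cases (0, p.2) (fun i => ((τ (i, p.2)).1.succ, (τ (i, p.2)).2)) p.1
  invFun p := Fin.cases (0, p.2) (fun i => ((τ.symm (i, p.2)).1.succ, (τ.symm (i, p.2)).2)) p.1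
  left_inv := by
    rintro ⟨i, b⟩
    refine Fin.cases ?_ (fun i => ?_) i <;> simp
  right_inv := by
    rintro ⟨i, b⟩
    refine Fin.cases ?_ (fun i => ?_) i <;> simp

lemma gext_gperm {m d : ℕ} (τ : Equiv.Perm (Fin d × Fin 2)) (j k : Fin m)
    (g : Fin d × Fin 2 → Fin m) : gext j k g ∘ gperm τ = gext j k (g ∘ τ) := by
  funext ⟨i, b⟩
  refine Fin.cases ?_ (fun i => ?_) i
  · rfl
  · simp [gext, gperm]

lemma orth_cols {m : ℕ} (A : Matrix (Fin m) (Fin m) ℂ) (hA : IsOrth A) (j k : Fin m) :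
    ∑ i, A i j * A i k = if j = k then 1 else 0 := by
  have := congrFun (congrFun hA j) k
  rw [Matrix.mul_apply, Matrix.one_apply] at this
  simpa using this

lemma orth_rows {m : ℕ} (A : Matrix (Fin m) (Fin m) ℂ) (hA : IsOrth A) (j k : Fin m) :
    ∑ i, A j i * A k i = if j = k then 1 else 0 := by
  have hA' : A * A.transpose = 1 := mul_eq_one_comm.mp hA
  have := congrFun (congrFun hA' j) k
  rw [Matrix.mul_apply, Matrix.one_apply] at this
  simpa using this

lemma gD_inv {m : ℕ} (A : Matrix (Fin m) (Fin m) ℂ) (hA : IsOrth A) (d : ℕ) :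
    gAct A (gD m d) = gD m d := by
  induction d with
  | zero =>
    funext f
    simp [gAct, gD]
  | succ d ih =>
    funext F
    obtain ⟨⟨j, k, g⟩, rfl⟩ := (gextE m d).surjective F
    change gAct A (gD m (d + 1)) (gext j k g) = gD m (d + 1) (gext j k g)
    rw [gD_gext, ← orth_rows A hA]
    conv_rhs => rw [← ih]
    unfold gAct
    rw [sum_gext, Finset.sum_mul_sum]
    apply Finset.sum_congr rfl
    intro j' _
    simp only [gD_gext, prod_gext]
    rw [Finset.sum_comm]
    apply Finset.sum_congr rfl
    intro g' _
    rw [Finset.sum_eq_single j']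
    · simp; ring
    · intro b _ hb
      simp [Ne.symm hb]
    · simp

/-- Contraction of the first pair. -/
noncomputable def gcon {m d : ℕ} (x : (Fin (d + 1) × Fin 2 → Fin m) → ℂ) :
    (Fin d × Fin 2 → Fin m) → ℂ := fun g => ∑ j, x (gext j j g)

lemma gcon_inv {m d : ℕ} (x : (Fin (d + 1) × Fin 2 → Fin m) → ℂ)
    (hx : ∀ A, IsOrth A → gAct A x = x) (A : Matrix (Fin m) (Fin m) ℂ) (hA : IsOrth A) :
    gAct A (gcon x) = gcon x := by
  funext g
  conv_rhs => rw [← hx A hA]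
  unfold gcon gAct
  simp only [sum_gext, prod_gext]
  have h1 : ∑ i, ∑ j', ∑ k', ∑ g' : Fin d × Fin 2 → Fin m,
      A i j' * A i k' * (∏ p, A (g p) (g' p)) * x (gext j' k' g')
      = ∑ j', ∑ k', ∑ g' : Fin d × Fin 2 → Fin m,
      (if j' = k' then 1 else 0) * ((∏ p, A (g p) (g' p)) * x (gext j' k' g')) := by
    rw [Finset.sum_comm]
    apply Finset.sum_congr rfl
    intro j' _
    rw [Finset.sum_comm]
    apply Finset.sum_congr rfl
    intro k' _
    rw [Finset.sum_comm]
    apply Finset.sum_congr rfl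
    intro g' _
    rw [← orth_cols A hA, Finset.sum_mul]
    apply Finset.sum_congr rfl
    intro i _
    ring
  rw [h1]
  simp only [Finset.mul_sum]
  rw [Finset.sum_comm]
  apply Finset.sum_congr rfl
  intro j _
  rw [Finset.sum_eq_single j]
  · simp
  · intro b _ hb
    simp [Ne.symm hb]
  · simp

lemma gcon_form {m d : ℕ} (x : (Fin (d + 1) × Fin 2 → Fin m) → ℂ)
    (τ : Equiv.Perm (Fin d × Fin 2)) :
    ∑ g, gcon x g * gD m d (g ∘ τ) = ∑ F, x F * gD m (d + 1) (F ∘ gperm τ) := by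
  rw [sum_gext]
  simp only [gext_gperm, gD_gext]
  unfold gcon
  simp only [Finset.sum_mul]
  rw [Finset.sum_comm]
  apply Finset.sum_congr rfl
  intro j _
  rw [Finset.sum_eq_single j]
  · simp
  · intro b _ hb
    simp [Ne.symm hb]
  · simp

lemma exists_perm_pair {α : Type} [DecidableEq α] (u v a b : α) (huv : u ≠ v) (hab : a ≠ b) :
    ∃ σ : Equiv.Perm α, σ u = a ∧ σ v = b := by
  refine ⟨Equiv.swap u a * Equiv.swap v (Equiv.swap u a b), ?_, ?_⟩
  · have h : u ≠ Equiv.swap u a b := by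
      intro h
      have h2 := congrArg (Equiv.swap u a) h
      simp at h2
      exact hab h2
    rw [Equiv.Perm.mul_apply, Equiv.swap_apply_of_ne_of_ne huv h, Equiv.swap_apply_left]
  · simp

lemma orth_zero {m : ℕ} (d : ℕ) : ∀ (x : (Fin d × Fin 2 → Fin m) → ℂ)
    (_ : ∀ A, IsOrth A → gAct A x = x)
    (_ : ∀ τ : Equiv.Perm (Fin d × Fin 2), ∑ f, x f * gD m d (f ∘ τ) = 0), x = 0 := by
  induction d with
  | zero =>
    intro x _ h
    have h1 := h 1
    funext f
    rw [Fintype.sum_eq_single f (fun g hg => absurd (Subsingleton.elim g f) hg)] at h1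
    simpa [gD] using h1
  | succ d ih =>
    intro x hx ho
    apply harm_zero x hx
    intro a b hab f
    obtain ⟨σ, ha, hb⟩ := exists_perm_pair ((0, 0) : Fin (d + 1) × Fin 2) (0, 1) a b
      (by simp) hab
    have hz : gcon (fun F : Fin (d + 1) × Fin 2 → Fin m => x (F ∘ σ.symm)) = 0 := by
      apply ih
      · intro A hA
        apply gcon_inv _ _ A hA
        intro A hA
        rw [gAct_comp, hx A hA]
      · intro τ
        rw [gcon_form]
        rw [← ho (σ * gperm τ)]
        refine Fintype.sum_equiv (Equiv.arrowCongr σ (Equiv.refl _)) _ _ ?_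
        intro F
        have h1 : (Equiv.arrowCongr σ (Equiv.refl (Fin m))) F = F ∘ σ.symm := by
          funext k; simp [Equiv.arrowCongr]
        rw [h1]
        congr 2
        funext k
        simp
    have h2 := congrFun hz (fun p => f (σ (p.1.succ, p.2)))
    unfold gcon at h2
    rw [Pi.zero_apply] at h2
    rw [← h2]
    apply Finset.sum_congr rfl
    intro j _
    congr 1
    funext p
    obtain ⟨⟨i, c⟩, rfl⟩ := σ.surjective p
    simp only [Function.comp, Equiv.symm_apply_apply]
    rw [← ha, ← hb]
    simp only [Function.update_apply, σ.injective.eq_iff]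
    refine Fin.cases ?_ (fun i => ?_) i
    · fin_cases c <;> simp [gext]
    · simp [gext]

lemma exists_proj {κ S : Type} [Fintype κ] (v : S → κ → ℂ) (x : κ → ℂ) :
    ∃ w ∈ Submodule.span ℂ (Set.range v), ∀ s, ∑ k, (x - w) k * (starRingEnd ℂ) (v s k) = 0 := by
  let e := (WithLp.linearEquiv 2 ℂ (κ → ℂ))
  let W : Submodule ℂ (EuclideanSpace ℂ κ) :=
    (Submodule.span ℂ (Set.range v)).map e.symm.toLinearMap
  refine ⟨e (W.starProjection (e.symm x)), ?_, ?_⟩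
  · have h := W.starProjection_apply_mem (e.symm x)
    obtain ⟨w, hw, hw'⟩ := h
    rw [← hw']
    simpa using hw
  · intro s
    have h := W.sub_starProjection_mem_orthogonal (e.symm x)
    have h2 := (Submodule.mem_orthogonal W _).mp h (e.symm (v s))
      (Submodule.mem_map_of_mem (Submodule.subset_span ⟨s, rfl⟩))
    rw [PiLp.inner_apply] at h2
    rw [← h2]
    rfl

lemma gFFT {m : ℕ} (d : ℕ) (x : (Fin d × Fin 2 → Fin m) → ℂ)
    (hx : ∀ A, IsOrth A → gAct A x = x) :
    x ∈ Submodule.span ℂ (Set.range fun τ : Equiv.Perm (Fin d × Fin 2) =>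
      fun f : Fin d × Fin 2 → Fin m => gD m d (f ∘ τ)) := by
  obtain ⟨w, hw, ho⟩ := exists_proj (fun τ : Equiv.Perm (Fin d × Fin 2) =>
      fun f : Fin d × Fin 2 → Fin m => gD m d (f ∘ τ)) x
  have hwinv : ∀ A, IsOrth A → gAct A w = w := by
    intro A hA
    clear ho
    induction hw using Submodule.span_induction with
    | mem y hy =>
      obtain ⟨τ, rfl⟩ := hy
      dsimp only
      rw [gAct_comp, gD_inv A hA]
    | zero => funext f; simp [gAct]
    | add y z _ _ hy hz =>
      have : gAct A (y + z) = gAct A y + gAct A z := by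
        funext f
        simp [gAct, mul_add, Finset.sum_add_distrib]
      rw [this, hy, hz]
    | smul c y _ hy =>
      have : gAct A (c • y) = c • gAct A y := by
        funext f
        simp only [gAct, Pi.smul_apply, smul_eq_mul, Finset.mul_sum]
        exact Finset.sum_congr rfl fun f' _ => by ring
      rw [this, hy]
  have hz : x - w = 0 := by
    apply orth_zero d
    · intro A hA
      rw [gAct_sub, hx A hA, hwinv A hA]
    · intro τ
      rw [← ho τ]
      apply Finset.sum_congr rfl
      intro f _
      congr 1
      simp [gD, map_prod, apply_ite (starRingEnd ℂ)]
  rw [sub_eq_zero.mp hz]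
  exact hw

/-- The standard index bijection. -/
def gidx (d : ℕ) : Fin d × Fin 2 ≃ Fin (2 * d) :=
  finProdFinEquiv.trans (finCongr (mul_comm d 2))

lemma cCpow_eq (m d : ℕ) (f : Fin (2 * d) → Fin m) : cCpow m d f = gD m d (f ∘ gidx d) := by
  unfold cCpow gD
  apply Finset.prod_congr rfl
  intro i _
  have h0 : gidx d (i, 0) = ⟨2 * i, by have := i.isLt; omega⟩ := by
    apply Fin.ext; simp [gidx, finProdFinEquiv]
  have h1 : gidx d (i, 1) = ⟨2 * i + 1, by have := i.isLt; omega⟩ := by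
    apply Fin.ext; simp [gidx, finProdFinEquiv, add_comm]
  simp only [Function.comp, h0, h1]

lemma act_eq_gAct {m r : ℕ} (A : Matrix (Fin m) (Fin m) ℂ) (x : Tens m r) :
    act A x = gAct A x := rfl

/-- FFT for `O(V)`, tensor form: `(V^{⊗r})^{O(V)} = 0` for odd `r`, and for `r = 2d`
the invariants are spanned by the `S_{2d}`-orbit of `Č^{⊗d}` (whose members are indeed
invariant). -/
theorem stmt_10 (m : ℕ) :
    (∀ r : ℕ, Odd r → ∀ x : Tens m r,
      (∀ A : Matrix (Fin m) (Fin m) ℂ, IsOrth A → act A x = x) → x = 0) ∧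
    (∀ d : ℕ, ∀ σ : Equiv.Perm (Fin (2 * d)), ∀ A : Matrix (Fin m) (Fin m) ℂ,
      IsOrth A → act A (permAct σ (cCpow m d)) = permAct σ (cCpow m d)) ∧
    ∀ d : ℕ, ∀ x : Tens m (2 * d),
      (∀ A : Matrix (Fin m) (Fin m) ℂ, IsOrth A → act A x = x) →
      x ∈ Submodule.span ℂ
        (Set.range fun σ : Equiv.Perm (Fin (2 * d)) => permAct σ (cCpow m d)) := by
  refine ⟨?_, ?_, ?_⟩
  · intro r hr x hx
    funext f
    have h := congrFun (hx _ (isOrth_diag (fun _ => -1) (by simp))) f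
    rw [act_eq_gAct, gAct_diag] at h
    simp only [Finset.prod_const, Finset.card_univ, Fintype.card_fin, hr.neg_one_pow] at h
    rw [Pi.zero_apply]
    linear_combination (-1/2) * h
  · intro d σ A hA
    have h : permAct σ (cCpow m d) = fun f => gD m d (f ∘ ((gidx d).trans σ)) := by
      funext f
      unfold permAct
      rw [cCpow_eq]
      rfl
    rw [h, act_eq_gAct, gAct_comp, gD_inv A hA]
  · intro d x hx
    have h1 := gFFT d (fun f => x (f ∘ (gidx d).symm)) (by
      intro A hA
      rw [gAct_comp, ← act_eq_gAct, hx A hA])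
    let T : ((Fin d × Fin 2 → Fin m) → ℂ) →ₗ[ℂ] Tens m (2 * d) :=
      LinearMap.funLeft ℂ ℂ (fun f : Fin (2 * d) → Fin m => f ∘ gidx d)
    have h2 := Submodule.mem_map_of_mem (f := T) h1
    have h3 : T (fun f => x (f ∘ (gidx d).symm)) = x := by
      funext f
      simp [T, LinearMap.funLeft_apply, Function.comp_assoc]
    rw [h3, Submodule.map_span] at h2
    refine Submodule.span_mono ?_ h2
    rintro _ ⟨_, ⟨τ, rfl⟩, rfl⟩
    refine ⟨((gidx d).symm.trans τ).trans (gidx d), ?_⟩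
    funext f
    simp only [permAct, cCpow_eq, T, LinearMap.funLeft_apply]
    congr 1
    funext k
    simp

end EnhBrauer
end

section
/- Let V = ℂ^m, G = O(V), and let Λ ∈ (V^{⊗r_c})^{G,det} be harmonic with (Λ,Λ) ≠ 0. Then for r ≥ r_c with r − r_c even, (V^{⊗r})^{G,det} is spanned by the elements σ·(Λ ⊗ Č^{⊗(r−r_c)/2}) for σ ∈ S_r; and (V^{⊗r})^{G,det} = 0 if r − r_c is odd or r < r_c. -/
open scoped BigOperators

namespace EnhBrauer

section Helpers
variable {m r : ℕ}

def DetSemi (x : Tens m r) : Prop :=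
  ∀ A : Matrix (Fin m) (Fin m) ℂ, IsOrth A → act A x = A.det • x

noncomputable def E (p q : Fin m) (x : Tens m r) : Tens m r :=
  fun f => ∑ k : Fin r, if f k = p then x (Function.update f k q) else 0

def cnt (p : Fin m) (f : Fin r → Fin m) : ℕ := (Finset.univ.filter fun k => f k = p).card

lemma E_diag (p : Fin m) (x : Tens m r) (f) : E p p x f = cnt p f * x f := by
  unfold E cnt
  rw [Finset.card_filter]; push_cast; rw [Finset.sum_mul]
  refine Finset.sum_congr rfl fun k _ => ?_
  split_ifs with h
  · rw [← h, Function.update_eq_self]; simp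
  · simp

lemma E_sq (x : Tens m r) (hx : Harmonic x) (p : Fin m) (f) :
    ∑ q, E p q (E p q x) f = cnt p f * x f := by
  rw [← E_diag]
  unfold E
  rw [Finset.sum_comm]
  refine Finset.sum_congr rfl fun k _ => ?_
  split_ifs with h
  · rw [Finset.sum_comm, Finset.sum_eq_single k]
    · simp
    · intro l _ hl
      simp only [Function.update_of_ne hl]
      split_ifs
      · exact hx k l (Ne.symm hl) f
      · simp
    · simp
  · simp

lemma E_adj (p q : Fin m) (x y : Tens m r) :
    ∑ f, star (x f) * E p q y f = ∑ f, star (E q p x f) * y f := by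
  unfold E
  simp only [Finset.mul_sum, star_sum, Finset.sum_mul]
  rw [Finset.sum_comm]
  conv_rhs => rw [Finset.sum_comm]
  refine Finset.sum_congr rfl fun k _ => ?_
  simp only [mul_ite, mul_zero, apply_ite star, star_zero, ite_mul, zero_mul]
  rw [← Finset.sum_filter, ← Finset.sum_filter]
  refine Finset.sum_bij' (fun f _ => Function.update f k q) (fun f _ => Function.update f k p)
    ?_ ?_ ?_ ?_ ?_
  · intro f hf; simp
  · intro f hf; simp
  · intro f hf
    simp only [Finset.mem_filter, Finset.mem_univ, true_and] at hf
    simp [← hf]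
  · intro f hf
    simp only [Finset.mem_filter, Finset.mem_univ, true_and] at hf
    simp [← hf]
  · intro f hf
    simp only [Finset.mem_filter, Finset.mem_univ, true_and] at hf
    simp [← hf]

lemma cnt_le_one (x : Tens m r) (hx : Harmonic x)
    (hE : ∀ p q, p ≠ q → E p q x = E q p x) (p : Fin m) (f) (hf : x f ≠ 0) : cnt p f ≤ 1 := by
  have h1 : ∀ f, ((cnt p f : ℂ) * cnt p f - cnt p f) * x f +
      ∑ q ∈ Finset.univ.erase p, E p q (E q p x) f = 0 := by
    intro f
    have := E_sq x hx p f
    rw [← Finset.add_sum_erase _ _ (Finset.mem_univ p), E_diag, E_diag] at this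
    have h2 : ∑ q ∈ Finset.univ.erase p, E p q (E q p x) f
        = ∑ q ∈ Finset.univ.erase p, E p q (E p q x) f := by
      refine Finset.sum_congr rfl fun q hq => ?_
      rw [hE p q (Finset.ne_of_mem_erase hq).symm]
    rw [h2]; linear_combination this
  have h3 : ∑ f, ((cnt p f : ℝ) * cnt p f - cnt p f) * Complex.normSq (x f) +
      ∑ q ∈ Finset.univ.erase p, ∑ f, Complex.normSq (E q p x f) = 0 := by
    have h4 : ∑ f, star (x f) * (((cnt p f : ℂ) * cnt p f - cnt p f) * x f +
      ∑ q ∈ Finset.univ.erase p, E p q (E q p x) f) = 0 := by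
      exact Finset.sum_eq_zero fun f _ => by rw [h1 f, mul_zero]
    simp only [mul_add, Finset.mul_sum, Finset.sum_add_distrib] at h4
    rw [Finset.sum_comm (s := Finset.univ) (t := Finset.univ.erase p)] at h4
    have h4' : ∀ q, ∑ f, star (x f) * E p q (E q p x) f = ∑ f, star (E q p x f) * E q p x f :=
      fun q => E_adj p q x (E q p x)
    simp only [h4'] at h4
    have : ((∑ f, ((cnt p f : ℝ) * cnt p f - cnt p f) * Complex.normSq (x f) +
      ∑ q ∈ Finset.univ.erase p, ∑ f, Complex.normSq (E q p x f) : ℝ) : ℂ) = 0 := by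
      rw [← h4]
      push_cast
      simp only [Complex.normSq_eq_conj_mul_self, starRingEnd_apply]
      congr 1
      refine Finset.sum_congr rfl fun k _ => ?_
      ring
    exact_mod_cast this
  have hn : ∀ n : ℕ, 0 ≤ (n : ℝ) * n - n := by
    intro n
    have : (n : ℝ) ≤ n * n := by exact_mod_cast Nat.le_mul_self n
    linarith
  have h5 : ∑ f, ((cnt p f : ℝ) * cnt p f - cnt p f) * Complex.normSq (x f) = 0 := by
    apply le_antisymm
    · have : 0 ≤ ∑ q ∈ Finset.univ.erase p, ∑ f, Complex.normSq (E q p x f) :=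
        Finset.sum_nonneg fun q _ => Finset.sum_nonneg fun f _ => Complex.normSq_nonneg _
      linarith
    · exact Finset.sum_nonneg fun f _ => mul_nonneg (hn _) (Complex.normSq_nonneg _)
  rw [Finset.sum_eq_zero_iff_of_nonneg
    (fun f _ => mul_nonneg (hn _) (Complex.normSq_nonneg _))] at h5
  have h6 := h5 f (Finset.mem_univ _)
  have h7 : Complex.normSq (x f) ≠ 0 := by simpa using hf
  have h8 : (cnt p f : ℝ) * cnt p f = cnt p f := by
    rcases mul_eq_zero.1 h6 with h | h
    · linarith
    · exact absurd h h7
  have h9 : cnt p f * cnt p f = cnt p f := by exact_mod_cast h8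
  by_contra hc
  push Not at hc
  nlinarith

lemma collapse (f : Fin r → Fin m) (k : Fin r) (F : (Fin r → Fin m) → ℂ) :
    ∑ f' : Fin r → Fin m, (∏ i ∈ Finset.univ.erase k, (1 : Matrix (Fin m) (Fin m) ℂ) (f i) (f' i)) * F f'
      = ∑ j, F (Function.update f k j) := by
  symm
  refine Finset.sum_of_injOn (fun j => Function.update f k j) ?_ (by simp) ?_ ?_
  · intro a _ b _ h
    have := congrFun h k
    simpa using this
  · intro f' _ hf'
    have : ∃ i ∈ Finset.univ.erase k, f i ≠ f' i := by
      by_contra hc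
      push Not at hc
      apply hf'
      refine ⟨f' k, by simp, ?_⟩
      funext i
      by_cases h : i = k
      · subst h; simp
      · simp [h, hc i (by simp [h])]
    obtain ⟨i, hi, hne⟩ := this
    rw [Finset.prod_eq_zero hi (by simp [hne]), zero_mul]
  · intro j _
    rw [Finset.prod_eq_one, one_mul]
    intro i hi
    show (1 : Matrix (Fin m) (Fin m) ℂ) (f i) (Function.update f k j i) = 1
    rw [Function.update_of_ne (Finset.ne_of_mem_erase hi)]; simp

noncomputable def Pm (p q : Fin m) : Matrix (Fin m) (Fin m) ℂ :=
  Matrix.single p p 1 + Matrix.single q q 1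
noncomputable def Jm (p q : Fin m) : Matrix (Fin m) (Fin m) ℂ :=
  Matrix.single p q 1 - Matrix.single q p 1
noncomputable def Rm (p q : Fin m) (t : ℂ) : Matrix (Fin m) (Fin m) ℂ :=
  1 + (Complex.cos t - 1) • Pm p q + Complex.sin t • Jm p q

lemma Rm_mul (p q : Fin m) (h : p ≠ q) (s t : ℂ) : Rm p q s * Rm p q t = Rm p q (s + t) := by
  have h1 : Pm p q * Pm p q = Pm p q := by
    simp [Pm, add_mul, mul_add, h, h.symm]
  have h2 : Pm p q * Jm p q = Jm p q := by
    simp only [Pm, Jm]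
    rw [add_mul, mul_sub, mul_sub]
    simp [h, h.symm]; abel
  have h3 : Jm p q * Pm p q = Jm p q := by
    simp only [Pm, Jm]
    rw [sub_mul, mul_add, mul_add]
    simp [h, h.symm]
  have h4 : Jm p q * Jm p q = - Pm p q := by
    simp only [Pm, Jm]
    rw [sub_mul, mul_sub, mul_sub]
    simp [h, h.symm]; abel
  unfold Rm
  simp only [add_mul, mul_add, one_mul, mul_one, smul_mul_smul_comm, h1, h2, h3, h4,
    Complex.cos_add, Complex.sin_add]
  module

lemma Rm_zero (p q : Fin m) : Rm p q 0 = 1 := by simp [Rm]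

lemma Rm_transpose (p q : Fin m) (t : ℂ) : (Rm p q t).transpose = Rm p q (-t) := by
  simp [Rm, Pm, Jm, Matrix.transpose_add, Matrix.transpose_sub, Matrix.transpose_smul, smul_sub]
  abel

lemma Rm_orth (p q : Fin m) (h : p ≠ q) (t : ℂ) : IsOrth (Rm p q t) := by
  unfold IsOrth
  rw [Rm_transpose, Rm_mul _ _ h, neg_add_cancel, Rm_zero]

lemma Rm_det (p q : Fin m) (h : p ≠ q) (t : ℂ) : (Rm p q t).det = 1 := by
  have h1 := congrArg Matrix.det (Rm_orth p q h (t / 2))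
  rw [Matrix.det_mul, Matrix.det_transpose, ← Matrix.det_mul, Rm_mul _ _ h, add_halves,
    Matrix.det_one] at h1
  exact h1

lemma Rm_deriv (p q i j : Fin m) : HasDerivAt (fun t => Rm p q t i j) (Jm p q i j) 0 := by
  have h1 : HasDerivAt (fun t => (1 : Matrix (Fin m) (Fin m) ℂ) i j +
      (Complex.cos t - 1) * Pm p q i j + Complex.sin t * Jm p q i j)
      ((-Complex.sin 0) * Pm p q i j + Complex.cos 0 * Jm p q i j) 0 :=
    ((((Complex.hasDerivAt_cos 0).sub_const 1).mul_const _).const_add _).add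
      ((Complex.hasDerivAt_sin 0).mul_const _)
  simpa [Rm] using h1

lemma E_symm (x : Tens m r) (hx : DetSemi x) (p q : Fin m) (h : p ≠ q) : E p q x = E q p x := by
  funext f
  have h1 : HasDerivAt (fun t => act (Rm p q t) x f)
      (∑ f' : Fin r → Fin m, (∑ k, (∏ i ∈ Finset.univ.erase k,
        (Rm p q 0) (f i) (f' i)) • Jm p q (f k) (f' k)) * x f') 0 := by
    unfold act
    refine HasDerivAt.fun_sum fun f' _ => HasDerivAt.mul_const ?_ _
    exact HasDerivAt.fun_finsetProd fun k _ => Rm_deriv p q _ _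
  have h2 : (fun t => act (Rm p q t) x f) = fun _ => x f := by
    funext t
    rw [hx _ (Rm_orth p q h t), Rm_det p q h]; simp
  rw [h2] at h1
  have h3 := h1.unique (hasDerivAt_const _ _)
  rw [Rm_zero] at h3
  simp only [Finset.sum_mul, smul_eq_mul] at h3
  rw [Finset.sum_comm] at h3
  simp only [mul_assoc] at h3
  simp only [collapse f _ (fun f' => _ * x f')] at h3
  rw [← sub_eq_zero, ← h3]
  unfold E
  rw [← Finset.sum_sub_distrib]
  refine Finset.sum_congr rfl fun k _ => ?_
  simp only [Jm, Function.update_self, Matrix.sub_apply, Matrix.single_apply, sub_mul,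
    Finset.sum_sub_distrib, ite_mul, one_mul, zero_mul, ite_and]
  simp [eq_comm]

lemma cnt_odd (x : Tens m r) (hx : DetSemi x) (p : Fin m) (f) (hf : x f ≠ 0) : Odd (cnt p f) := by
  let d : Fin m → ℂ := fun i => if i = p then -1 else 1
  have ho : IsOrth (Matrix.diagonal d) := by
    unfold IsOrth
    rw [Matrix.diagonal_transpose, Matrix.diagonal_mul_diagonal, ← Matrix.diagonal_one]
    congr 1
    funext i
    simp only [d]; split_ifs <;> simp
  have h1 := congrFun (hx _ ho) f
  have h2 : act (Matrix.diagonal d) x f = (∏ i, d (f i)) * x f := by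
    unfold act
    rw [Finset.sum_eq_single f]
    · simp
    · intro f' _ hne
      have : ∃ i, f i ≠ f' i := by
        by_contra hc; push Not at hc; exact hne (funext fun i => (hc i).symm)
      obtain ⟨i, hi⟩ := this
      rw [Finset.prod_eq_zero (Finset.mem_univ i) (by simp [hi]), zero_mul]
    · simp
  rw [h2, Matrix.det_diagonal] at h1
  have h3 : ∏ i, d (f i) = (-1) ^ cnt p f := by
    simp only [d, cnt]
    rw [Finset.prod_ite]; simp
  have h4 : ∏ i, d i = -1 := by simp [d]
  rw [h3, h4] at h1
  simp only [Pi.smul_apply, smul_eq_mul] at h1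
  have h5 := mul_right_cancel₀ hf h1
  by_contra hc
  rw [Nat.not_odd_iff_even] at hc
  rw [hc.neg_one_pow] at h5
  norm_num at h5

lemma supp_bij (x : Tens m r) (hx : DetSemi x) (hh : Harmonic x) (f) (hf : x f ≠ 0) :
    Function.Bijective f := by
  rw [Function.bijective_iff_existsUnique]
  intro p
  have h1 := cnt_le_one x hh (E_symm x hx) p f hf
  have h2 := (cnt_odd x hx p f hf).pos
  have h3 : cnt p f = 1 := by omega
  obtain ⟨k, hk⟩ := Finset.card_eq_one.1 h3
  refine ⟨k, ?_, ?_⟩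
  · have : k ∈ (Finset.univ.filter fun k => f k = p) := by rw [hk]; simp
    simpa using this
  · intro l hl
    have : l ∈ (Finset.univ.filter fun k => f k = p) := by simpa using hl
    rw [hk] at this; simpa using this

lemma harm_dim (x : Tens m r) (hx : DetSemi x) (hh : Harmonic x) (h0 : x ≠ 0) : r = m := by
  obtain ⟨f, hf⟩ := Function.ne_iff.1 h0
  simpa using Fintype.card_of_bijective (supp_bij x hx hh f hf)

lemma perm_val (x : Tens m m) (hx : DetSemi x) (τ : Equiv.Perm (Fin m)) :
    x τ = ((Equiv.Perm.sign τ : ℤ) : ℂ) * x id := by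
  have ho : IsOrth (Equiv.Perm.permMatrix ℂ τ) := by
    unfold IsOrth
    rw [Matrix.transpose_permMatrix, ← Matrix.permMatrix_mul]
    simp
  have h1 := congrFun (hx _ ho) id
  rw [Matrix.det_permutation] at h1
  rw [← smul_eq_mul, ← Pi.smul_apply, ← h1]
  unfold act
  rw [Finset.sum_eq_single (τ : Fin m → Fin m)]
  · simp [Equiv.Perm.permMatrix, PEquiv.toMatrix_apply]
  · intro f' _ hne
    have : ∃ i, τ i ≠ f' i := by
      by_contra hc; push Not at hc; exact hne (funext fun i => (hc i).symm)
    obtain ⟨i, hi⟩ := this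
    rw [Finset.prod_eq_zero (Finset.mem_univ i) (by simp [PEquiv.toMatrix_apply, hi]), zero_mul]
  · simp

lemma harm_prop (x y : Tens m m) (hx : DetSemi x) (hh : Harmonic x) (hy : DetSemi y)
    (hhy : Harmonic y) (h0 : y ≠ 0) : ∃ c : ℂ, x = c • y := by
  have key : ∀ z : Tens m m, DetSemi z → Harmonic z → ∀ f, ¬ Function.Bijective f → z f = 0 := by
    intro z hz hhz f hf
    by_contra hc
    exact hf (supp_bij z hz hhz f hc)
  have hid : y id ≠ 0 := by
    intro hid
    apply h0
    funext f
    by_cases hf : Function.Bijective f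
    · have := perm_val y hy (Equiv.ofBijective f hf)
      simp only [hid, mul_zero] at this
      exact this
    · exact key y hy hhy f hf
  refine ⟨x id / y id, ?_⟩
  funext f
  by_cases hf : Function.Bijective f
  · have h1 := perm_val y hy (Equiv.ofBijective f hf)
    have h2 := perm_val x hx (Equiv.ofBijective f hf)
    change y f = _ at h1
    change x f = _ at h2
    rw [Pi.smul_apply, h1, h2, smul_eq_mul]
    field_simp
  · simp [key y hy hhy f hf, key x hx hh f hf]

def sn (g : Fin r → Fin m) (k : Fin m) : Fin (r + 1) → Fin m := Fin.snoc (α := fun _ => Fin m) g k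

lemma sn_castSucc (g : Fin r → Fin m) (k : Fin m) (i : Fin r) : sn g k i.castSucc = g i := by
  simp [sn]
lemma sn_last (g : Fin r → Fin m) (k : Fin m) : sn g k (Fin.last r) = k := by
  simp [sn]

lemma sum_sn (F : (Fin (r + 1) → Fin m) → ℂ) : ∑ f, F f = ∑ g, ∑ k, F (sn g k) := by
  rw [← (Fin.snocEquiv (fun _ : Fin (r + 1) => Fin m)).sum_comp, Fintype.sum_prod_type_right]
  rfl

lemma sum_sn2 (F : (Fin (r + 2) → Fin m) → ℂ) :
    ∑ f, F f = ∑ g, ∑ k, ∑ l, F (sn (sn g k) l) := by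
  rw [sum_sn, sum_sn]

noncomputable def con (x : Tens m (r + 2)) : Tens m r := fun g => ∑ j, x (sn (sn g j) j)

def ins (y : Tens m r) : Tens m (r + 2) := fun h =>
  y (fun i => h i.castSucc.castSucc) * if h (Fin.last r).castSucc = h (Fin.last (r + 1)) then 1 else 0

lemma act_con (A : Matrix (Fin m) (Fin m) ℂ) (hA : IsOrth A) (x : Tens m (r + 2)) :
    con (act A x) = act A (con x) := by
  have hd : ∀ k l, ∑ j, A j k * A j l = if k = l then 1 else 0 := by
    intro k l
    have := congrFun (congrFun hA k) l
    rw [Matrix.mul_apply, Matrix.one_apply] at this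
    simpa using this
  funext g
  unfold con act
  simp only [sum_sn2, Fin.prod_univ_castSucc, sn_castSucc, sn_last]
  rw [Finset.sum_comm]
  refine Finset.sum_congr rfl fun g' _ => ?_
  rw [Finset.sum_comm, Finset.mul_sum]
  refine Finset.sum_congr rfl fun k _ => ?_
  rw [Finset.sum_comm]
  have : ∀ l, ∑ j, (∏ i, A (g i) (g' i)) * A j k * A j l * x (sn (sn g' k) l)
      = (if k = l then 1 else 0) * ((∏ i, A (g i) (g' i)) * x (sn (sn g' k) l)) := by
    intro l
    rw [← hd, Finset.sum_mul]
    exact Finset.sum_congr rfl fun j _ => by ring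
  simp [this]

lemma act_ins (A : Matrix (Fin m) (Fin m) ℂ) (hA : IsOrth A) (y : Tens m r) :
    act A (ins y) = ins (act A y) := by
  have hA' : A * A.transpose = 1 := mul_eq_one_comm.1 hA
  have hd : ∀ k l, ∑ j, A k j * A l j = if k = l then 1 else 0 := by
    intro k l
    have := congrFun (congrFun hA' k) l
    rw [Matrix.mul_apply, Matrix.one_apply] at this
    simpa using this
  funext h
  unfold ins act
  simp only [sum_sn2, Fin.prod_univ_castSucc, sn_castSucc, sn_last]
  rw [Finset.sum_mul]
  refine Finset.sum_congr rfl fun g' _ => ?_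
  rw [← hd, Finset.mul_sum]
  refine Finset.sum_congr rfl fun k _ => ?_
  simp
  ring

lemma sum_perm (σ : Equiv.Perm (Fin r)) (F : (Fin r → Fin m) → ℂ) :
    ∑ f : Fin r → Fin m, F (f ∘ σ) = ∑ f, F f :=
  (σ.symm.arrowCongr (Equiv.refl (Fin m))).sum_comp F

lemma perm_orth (σ τ : Equiv.Perm (Fin r)) (w y : Tens m r) :
    ∑ f, star (permAct σ w f) * permAct τ y f = ∑ f, star (permAct (τ⁻¹ * σ) w f) * y f := by
  conv_rhs => rw [← sum_perm τ]
  refine Finset.sum_congr rfl fun f _ => ?_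
  have : (f ∘ τ) ∘ (τ⁻¹ * σ : Equiv.Perm (Fin r)) = f ∘ σ := by
    funext i; simp
  simp only [permAct, this]

lemma act_perm (A : Matrix (Fin m) (Fin m) ℂ) (σ : Equiv.Perm (Fin r)) (x : Tens m r) :
    act A (permAct σ x) = permAct σ (act A x) := by
  funext f
  unfold act permAct
  conv_rhs => beta_reduce; rw [← sum_perm σ]
  refine Finset.sum_congr rfl fun f' _ => ?_
  congr 1
  exact (Equiv.prod_comp σ (fun i => A (f i) (f' i))).symm

lemma DetSemi.perm {x : Tens m r} (hx : DetSemi x) (σ : Equiv.Perm (Fin r)) :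
    DetSemi (permAct σ x) := by
  intro A hA; rw [act_perm, hx A hA]; rfl

lemma DetSemi.ins {x : Tens m r} (hx : DetSemi x) : DetSemi (ins x) := by
  intro A hA; rw [act_ins A hA, hx A hA]; funext h; simp [EnhBrauer.ins]

lemma DetSemi.con {x : Tens m (r + 2)} (hx : DetSemi x) : DetSemi (con x) := by
  intro A hA; rw [← act_con A hA, hx A hA]; funext h; simp [EnhBrauer.con, Finset.mul_sum]

lemma tmul_zero' {rc : ℕ} (L : Tens m rc) : tmul L (cCpow m 0) = L := by
  funext f
  simp only [tmul, cCpow, Finset.univ_eq_empty, Finset.prod_empty, mul_one]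
  rfl

lemma tmul_succ {rc : ℕ} (L : Tens m rc) (d : ℕ) :
    tmul L (cCpow m (d + 1)) = ins (tmul L (cCpow m d)) := by
  funext h
  simp only [tmul, cCpow, Fin.prod_univ_castSucc, ins]
  rw [← mul_assoc]
  rfl

lemma detSemi_tmul {rc : ℕ} (L : Tens m rc) (hL : DetSemi L) (d : ℕ) :
    DetSemi (tmul L (cCpow m d)) := by
  induction d with
  | zero => rw [tmul_zero']; exact hL
  | succ d ih => rw [tmul_succ]; exact ih.ins

lemma exists_ext (σ : Equiv.Perm (Fin r)) : ∃ σ' : Equiv.Perm (Fin (r + 2)),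
    ∀ w : Tens m r, ins (permAct σ w) = permAct σ' (ins w) := by
  let e : Equiv.Perm (Fin (r + 2)) :=
    finSumFinEquiv.permCongr (Equiv.sumCongr σ (Equiv.refl (Fin 2)))
  have h1 : ∀ i : Fin r, e i.castSucc.castSucc = (σ i).castSucc.castSucc := by
    intro i
    change e (Fin.castAdd 2 i) = Fin.castAdd 2 (σ i)
    simp [e, Equiv.permCongr_apply]
  have h2 : e (Fin.last r).castSucc = (Fin.last r).castSucc := by
    change e (Fin.natAdd r (0 : Fin 2)) = Fin.natAdd r (0 : Fin 2)
    simp [e, Equiv.permCongr_apply, -Fin.natAdd_zero]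
  have h3 : e (Fin.last (r + 1)) = Fin.last (r + 1) := by
    change e (Fin.natAdd r (1 : Fin 2)) = Fin.natAdd r (1 : Fin 2)
    simp [e, Equiv.permCongr_apply]
  refine ⟨e, fun w => ?_⟩
  funext h
  simp only [ins, permAct, Function.comp_apply, h1, h2, h3]
  rfl

lemma con_adj (w : Tens m r) (y : Tens m (r + 2)) :
    ∑ g, star (w g) * con y g = ∑ h, star (ins w h) * y h := by
  rw [sum_sn2]
  refine Finset.sum_congr rfl fun g _ => ?_
  unfold con
  rw [Finset.mul_sum]
  refine Finset.sum_congr rfl fun k _ => ?_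
  simp only [ins, sn_castSucc, sn_last]
  simp [apply_ite]

lemma exists_perm (a b : Fin (r + 2)) (hab : a ≠ b) : ∃ τ : Equiv.Perm (Fin (r + 2)),
    τ a = (Fin.last r).castSucc ∧ τ b = Fin.last (r + 1) := by
  let τ1 := Equiv.swap b (Fin.last (r + 1))
  have h1 : τ1 b = Fin.last (r + 1) := Equiv.swap_apply_left _ _
  have h2 : Fin.last (r + 1) ≠ τ1 a := by
    rw [← h1]; exact fun h => hab (τ1.injective h).symm
  refine ⟨Equiv.swap (τ1 a) (Fin.last r).castSucc * τ1, ?_, ?_⟩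
  · simp
  · rw [Equiv.Perm.mul_apply, h1, Equiv.swap_apply_of_ne_of_ne h2]
    exact (Fin.castSucc_lt_last _).ne'

lemma harmonic_of_con (y : Tens m (r + 2)) (hy : ∀ τ, con (permAct τ y) = 0) : Harmonic y := by
  intro a b hab f
  obtain ⟨τ, ha, hb⟩ := exists_perm a b hab
  have h := congrFun (hy τ) (fun i => f (τ.symm i.castSucc.castSucc))
  rw [Pi.zero_apply] at h
  rw [← h]
  unfold con permAct
  refine Finset.sum_congr rfl fun j _ => ?_
  congr 1
  funext i
  obtain ⟨i, rfl⟩ := τ.symm.surjective i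
  have ha' : a = τ.symm (Fin.last r).castSucc := by rw [← ha]; simp
  have hb' : b = τ.symm (Fin.last (r + 1)) := by rw [← hb]; simp
  subst ha' hb'
  simp only [Function.comp_apply, Equiv.apply_symm_apply, Function.update_apply,
    τ.symm.injective.eq_iff]
  refine Fin.lastCases ?_ (fun i => ?_) i
  · simp [sn_last]
  · refine Fin.lastCases ?_ (fun i => ?_) i
    · simp [sn_last, sn_castSucc]
    · simp [sn_castSucc, (Fin.castSucc_lt_last _).ne]

lemma vanish (rc : ℕ) (hrc : rc = m) (r : ℕ) : ¬(rc ≤ r ∧ Even (r - rc)) →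
    ∀ x : Tens m r, DetSemi x → x = 0 := by
  induction r using Nat.twoStepInduction with
  | zero =>
    intro h x hx
    by_contra h0
    have := harm_dim x hx (fun a => a.elim0) h0
    apply h; subst hrc; subst this; simp
  | one =>
    intro h x hx
    by_contra h0
    have := harm_dim x hx (fun a b hab => absurd (Subsingleton.elim a b) hab) h0
    apply h; subst hrc; subst this; simp
  | more r ih _ =>
    intro h x hx
    by_contra h0
    have hh : Harmonic x := by
      apply harmonic_of_con
      intro τ
      refine ih ?_ _ (hx.perm τ).con
      rintro ⟨h1, h2⟩
      apply h
      refine ⟨by omega, ?_⟩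
      have : r + 2 - rc = r - rc + 2 := by omega
      rw [this]; exact h2.add even_two
    have := harm_dim x hx hh h0
    apply h; subst hrc; subst this; simp

lemma orth_decomp {ι : Type*} [Fintype ι] (W : Submodule ℂ (ι → ℂ)) (x : ι → ℂ) :
    ∃ u ∈ W, ∃ y, x = u + y ∧ ∀ w ∈ W, ∑ i, star (w i) * y i = 0 := by
  let e := WithLp.linearEquiv 2 ℂ (ι → ℂ)
  let W' : Submodule ℂ (EuclideanSpace ℂ ι) := W.comap e.toLinearMap
  obtain ⟨u, hu, y, hy, h⟩ := W'.exists_add_mem_mem_orthogonal (e.symm x)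
  refine ⟨e u, hu, e y, ?_, ?_⟩
  · rw [← map_add, ← h]; simp
  · intro w hw
    have := hy (e.symm w) (by simpa [W'] using hw)
    rw [PiLp.inner_apply] at this
    simp only [RCLike.inner_apply'] at this
    exact this

lemma spanning {rc : ℕ} (L : Tens m rc) (hL : DetSemi L) (hh : Harmonic L) (h0 : L ≠ 0)
    (d : ℕ) : ∀ x : Tens m (rc + 2 * d), DetSemi x →
      x ∈ Submodule.span ℂ (Set.range fun σ : Equiv.Perm (Fin (rc + 2 * d)) =>
          permAct σ (tmul L (cCpow m d))) := by
  have hrc := harm_dim L hL hh h0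
  subst hrc
  induction d with
  | zero =>
    intro x hx
    have hxh : Harmonic x := by
      obtain _ | _ | r := rc
      · exact fun a => a.elim0
      · exact fun a b hab => absurd (Subsingleton.elim (α := Fin 1) a b) hab
      · refine harmonic_of_con (r := r) x fun τ => ?_
        refine vanish (r + 2) rfl r (by omega) _ (DetSemi.con (hx.perm τ))
    obtain ⟨c, hc⟩ := harm_prop x L hx hxh hL hh h0
    rw [hc]
    refine Submodule.smul_mem _ _ (Submodule.subset_span ⟨1, ?_⟩)
    change permAct 1 (tmul L (cCpow rc 0)) = L
    rw [tmul_zero']; rfl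
  | succ d ih =>
    intro x hx
    set W := Submodule.span ℂ (Set.range fun σ : Equiv.Perm (Fin (rc + 2 * (d + 1))) =>
          permAct σ (tmul L (cCpow rc (d + 1)))) with hW
    obtain ⟨u, hu, y, hxy, hy⟩ := orth_decomp W x
    have hWd : ∀ u ∈ W, DetSemi u := by
      intro u hu
      induction hu using Submodule.span_induction with
      | mem u h =>
        obtain ⟨σ, rfl⟩ := h
        exact (detSemi_tmul L hL _).perm σ
      | zero => intro A hA; rw [act_zero, smul_zero]
      | add a b _ _ h1 h2 => intro A hA; rw [act_add, h1 A hA, h2 A hA, smul_add]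
      | smul c a _ h1 => intro A hA; rw [act_smul, h1 A hA, smul_comm]
    have hyd : DetSemi y := by
      have : y = x + (-1 : ℂ) • u := by rw [hxy]; module
      intro A hA
      rw [this, act_add, act_smul, hx A hA, hWd u hu A hA, smul_add, smul_comm]
    have hyh : Harmonic y := by
      refine harmonic_of_con (r := rc + 2 * d) y fun τ => ?_
      have hz : DetSemi (con (r := rc + 2 * d) (permAct τ y)) := DetSemi.con (hyd.perm τ)
      have hmem := ih _ hz
      have horth : ∀ w ∈ Submodule.span ℂ (Set.range fun σ : Equiv.Perm (Fin (rc + 2 * d)) =>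
          permAct σ (tmul L (cCpow rc d))),
          ∑ g, star (w g) * con (r := rc + 2 * d) (permAct τ y) g = 0 := by
        intro w hw
        induction hw using Submodule.span_induction with
        | mem w h =>
          obtain ⟨σ, rfl⟩ := h
          obtain ⟨σ', hσ'⟩ := exists_ext (m := rc) σ
          simp only
          rw [con_adj, hσ', ← tmul_succ]
          rw [← hy (permAct (τ⁻¹ * σ') (tmul L (cCpow rc (d + 1)))) (Submodule.subset_span ⟨_, rfl⟩)]
          exact perm_orth σ' τ _ y
        | zero => simp
        | add a b _ _ h1 h2 =>
          simp only [Pi.add_apply, star_add, add_mul, Finset.sum_add_distrib, h1, h2, add_zero]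
        | smul c a _ h1 =>
          simp only [Pi.smul_apply, smul_eq_mul, star_mul', mul_assoc, ← Finset.mul_sum, h1, mul_zero]
      have h1 := horth _ hmem
      funext g
      have h2 : ∑ g, Complex.normSq (con (r := rc + 2 * d) (permAct τ y) g) = 0 := by
        have : ((∑ g, Complex.normSq (con (r := rc + 2 * d) (permAct τ y) g) : ℝ) : ℂ) = 0 := by
          rw [← h1]; push_cast
          simp only [Complex.normSq_eq_conj_mul_self, starRingEnd_apply]
        exact_mod_cast this
      rw [Finset.sum_eq_zero_iff_of_nonneg (fun _ _ => Complex.normSq_nonneg _)] at h2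
      simpa using h2 g (Finset.mem_univ _)
    have hy0 : y = 0 := by
      by_contra hne
      have := harm_dim y hyd hyh hne
      omega
    rw [hxy, hy0, add_zero]
    exact hu


end Helpers

/-- Theorem on `SO`-invariants: given a harmonic `Λ ∈ (V^{⊗ r_c})^{G,det}` with
`(Λ,Λ) ≠ 0`, for `r = r_c + 2d` the space `(V^{⊗r})^{G,det}` is spanned by the
`S_r`-orbit of `Λ ⊗ Č^{⊗ d}` (whose members are indeed det-semiinvariant), and
`(V^{⊗r})^{G,det} = 0` unless `r ≥ r_c` and `r - r_c` is even. -/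
theorem stmt_12 (m rc : ℕ) (L : Tens m rc)
    (hLdet : ∀ A : Matrix (Fin m) (Fin m) ℂ, IsOrth A → act A L = A.det • L)
    (hLharm : Harmonic L) (hLnorm : form L L ≠ 0) :
    (∀ d : ℕ, ∀ σ : Equiv.Perm (Fin (rc + 2 * d)), ∀ A : Matrix (Fin m) (Fin m) ℂ,
      IsOrth A → act A (permAct σ (tmul L (cCpow m d))) =
        A.det • permAct σ (tmul L (cCpow m d))) ∧
    (∀ d : ℕ, ∀ x : Tens m (rc + 2 * d),
      (∀ A : Matrix (Fin m) (Fin m) ℂ, IsOrth A → act A x = A.det • x) →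
      x ∈ Submodule.span ℂ
        (Set.range fun σ : Equiv.Perm (Fin (rc + 2 * d)) =>
          permAct σ (tmul L (cCpow m d)))) ∧
    ∀ r : ℕ, ¬(rc ≤ r ∧ Even (r - rc)) →
      ∀ x : Tens m r,
        (∀ A : Matrix (Fin m) (Fin m) ℂ, IsOrth A → act A x = A.det • x) → x = 0 := by
  have h0 : L ≠ 0 := by
    rintro rfl
    apply hLnorm; simp [form]
  have hrc := harm_dim L hLdet hLharm h0
  refine ⟨fun d σ => (detSemi_tmul L hLdet d).perm σ, fun d => spanning L hLdet hLharm h0 d,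
    fun r => vanish rc hrc r⟩

end EnhBrauer
end
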